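/- Let N and m be positive integers and let X₁, …, X_m ⊆ {1,…,N} be given subsets. For a real symmetric positive semidefinite N×N matrix K with all eigenvalues in [0,1] define L(K) = ∏_{j=1}^{m} |det(K − I_{X̄ⱼ})|, where for X ⊆ {1,…,N}, I_{X̄} denotes the diagonal 0/1 matrix with ones exactly on the diagonal entries indexed by the complement of X. Then there exists a real symmetric positive semidefinite N×N matrix K with all eigenvalues in [0,1] such that L(K) ≥ L(K′) for every real symmetric positive semidefinite N×N matrix K′ with all eigenvalues in [0,1], and such that K_{ii} = |{j : i ∈ Xⱼ}| / m for every i ∈ {1,…,N}. -/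

import Mathlib

open Matrix

theorem Matrix.IsHermitian.posSemidef_one_sub_iff {n : Type*} [Fintype n] [DecidableEq n]
    {A : Matrix n n ℝ} (hA : A.IsHermitian) :
    (1 - A).PosSemidef ↔ ∀ i, hA.eigenvalues i ≤ 1 := by
  set U := hA.eigenvectorUnitary
  have h : 1 - A = (U : Matrix n n ℝ) * diagonal (fun i => 1 - hA.eigenvalues i) *
      star (U : Matrix n n ℝ) := by
    have h1 : diagonal (fun i => 1 - hA.eigenvalues i) = 1 - diagonal hA.eigenvalues := by
      rw [← diagonal_one, diagonal_sub]
    have h2 := hA.spectral_theorem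
    rw [Unitary.conjStarAlgAut_apply] at h2
    rw [h1, mul_sub, sub_mul, mul_one, ← Unitary.coe_star, Unitary.coe_mul_star_self,
      Unitary.coe_star]
    conv_lhs => rw [h2]
    rfl
  rw [h, (Unitary.isUnit_coe (U := U)).posSemidef_star_right_conjugate_iff,
    posSemidef_diagonal_iff]
  simp

section Tilt

variable {n : Type*} [Fintype n] [DecidableEq n]

/-- The marginal kernel of the determinantal process with kernel `K`, reweighted by the factor
`b ^ 2` on the sets containing `i`. -/
noncomputable def tiltKernel (K : Matrix n n ℝ) (i : n) (b : ℝ) : Matrix n n ℝ :=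
  diagonal (fun p => if p = i then b else 1) *
    (K - ((b ^ 2 - 1) / (1 + (b ^ 2 - 1) * K i i)) • vecMulVec (fun p => K p i) (K i)) *
    diagonal (fun p => if p = i then b else 1)

theorem tiltKernel_apply (K : Matrix n n ℝ) (i : n) (b : ℝ) (p q : n) :
    tiltKernel K i b p q = (if p = i then b else 1) *
      (K p q - (b ^ 2 - 1) / (1 + (b ^ 2 - 1) * K i i) * (K p i * K i q)) *
      (if q = i then b else 1) := by
  simp [tiltKernel, vecMulVec_apply]

theorem one_add_sq_sub_one_mul_pos {b k : ℝ} (hb : 0 < b) (h0 : 0 ≤ k) (h1 : k ≤ 1) :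
    0 < 1 + (b ^ 2 - 1) * k := by
  rcases h0.eq_or_lt with rfl | h0
  · simp
  · nlinarith [mul_pos (pow_pos hb 2) h0]

theorem Matrix.PosSemidef.sq_mulVec_apply_le {K : Matrix n n ℝ} (hK : K.PosSemidef) (i : n)
    (x : n → ℝ) : (K *ᵥ x) i ^ 2 ≤ K i i * (x ⬝ᵥ (K *ᵥ x)) := by
  have hT : Kᵀ = K := by simpa [IsHermitian, conjTranspose_eq_transpose_of_trivial] using hK.1
  have h : ∀ t : ℝ, 0 ≤ K i i * (t * t) + (2 * (K *ᵥ x) i) * t + x ⬝ᵥ (K *ᵥ x) := by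
    intro t
    have h1 := hK.dotProduct_mulVec_nonneg (x + t • Pi.single i 1)
    have h2 : x ⬝ᵥ K.col i = (K *ᵥ x) i := by
      rw [dotProduct_comm]
      conv_rhs => rw [← hT]
      rfl
    simp [mulVec_add, mulVec_smul, dotProduct_add, add_dotProduct, h2] at h1
    linarith
  have := discrim_le_zero h
  simp only [discrim] at this
  nlinarith

theorem posSemidef_tiltKernel {K : Matrix n n ℝ} (hK : K.PosSemidef) (i : n) (h1 : K i i ≤ 1)
    {b : ℝ} (hb : 0 < b) : (tiltKernel K i b).PosSemidef := by
  have hT : Kᵀ = K := by simpa [IsHermitian, conjTranspose_eq_transpose_of_trivial] using hK.1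
  have hS : ∀ p q, K p q = K q p := fun p q => congrFun (congrFun hT q) p
  have hz := one_add_sq_sub_one_mul_pos hb hK.diag_nonneg h1
  set s := (b ^ 2 - 1) / (1 + (b ^ 2 - 1) * K i i) with hs
  have hsk : s * K i i ≤ 1 := by
    rw [hs, div_mul_eq_mul_div, div_le_one hz]; linarith
  have key : (K - s • vecMulVec (fun p => K p i) (K i)).PosSemidef := by
    refine .of_dotProduct_mulVec_nonneg ?_ fun x => ?_
    · ext p q
      simp [vecMulVec_apply, hS q p, hS q i, hS i p, mul_comm]
    · have hcs := hK.sq_mulVec_apply_le i x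
      have hx : 0 ≤ x ⬝ᵥ (K *ᵥ x) := by simpa using hK.dotProduct_mulVec_nonneg x
      have h2 : x ⬝ᵥ (fun p => K p i) = (K *ᵥ x) i := by
        simp only [hS _ i, mulVec]; exact dotProduct_comm _ _
      have h3 : star x ⬝ᵥ ((K - s • vecMulVec (fun p => K p i) (K i)) *ᵥ x) =
          x ⬝ᵥ (K *ᵥ x) - s * (K *ᵥ x) i ^ 2 := by
        simp [sub_mulVec, smul_mulVec, vecMulVec_mulVec, h2]
        rw [show K i ⬝ᵥ x = (K *ᵥ x) i from rfl, sq]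
        simp
      rw [h3]
      rcases le_total s 0 with h | h
      · nlinarith [sq_nonneg ((K *ᵥ x) i)]
      · nlinarith
  have := key.mul_mul_conjTranspose_same (diagonal (fun p => if p = i then b else 1))
  simpa [tiltKernel, diagonal_conjTranspose] using this

theorem one_sub_tiltKernel (K : Matrix n n ℝ) (i : n) {b : ℝ} (hb : 0 < b)
    (hz : 1 + (b ^ 2 - 1) * K i i ≠ 0) :
    1 - tiltKernel K i b = tiltKernel (1 - K) i b⁻¹ := by
  have hz' : 1 + (b⁻¹ ^ 2 - 1) * (1 - K i i) = (1 + (b ^ 2 - 1) * K i i) / b ^ 2 := by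
    field_simp; ring
  have hb' := hb.ne'
  ext p q
  rw [Matrix.sub_apply, tiltKernel_apply, tiltKernel_apply]
  simp only [Matrix.sub_apply, one_apply_eq, hz']
  generalize hzz : 1 + (b ^ 2 - 1) * K i i = z at *
  by_cases hp : p = i <;> by_cases hq : q = i
  · subst hp; subst hq; simp; field_simp; subst hzz; ring
  · subst hp; simp [hq, one_apply_ne (Ne.symm hq)]; field_simp; subst hzz; ring
  · subst hq; simp [hp, one_apply_ne hp]; field_simp; subst hzz; ring
  · simp [hp, hq, one_apply_ne hp, one_apply_ne (Ne.symm hq)]; field_simp; ring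

theorem det_tiltKernel_sub (K : Matrix n n ℝ) (i : n) {b : ℝ} (hb : 0 < b)
    (hz : 1 + (b ^ 2 - 1) * K i i ≠ 0) (Y : Finset n) :
    (tiltKernel K i b - diagonal fun p => if p ∈ Y then (0 : ℝ) else 1).det =
      (if i ∈ Y then b ^ 2 else 1) / (1 + (b ^ 2 - 1) * K i i) *
        (K - diagonal fun p => if p ∈ Y then (0 : ℝ) else 1).det := by
  set J : Matrix n n ℝ := diagonal fun p => if p ∈ Y then (0 : ℝ) else 1 with hJ
  set s := (b ^ 2 - 1) / (1 + (b ^ 2 - 1) * K i i) with hs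
  have hb' := hb.ne'
  have hfac : tiltKernel K i b - J =
      diagonal (fun p => if p = i then (if i ∈ Y then b else b⁻¹) else 1) *
        ((K - J) * (1 - vecMulVec (Pi.single i s) (K i))) *
        diagonal (fun p => if p = i then b else 1) := by
    have h1 : (K - J) * (1 - vecMulVec (Pi.single i s) (K i)) =
        of fun p q => (K - J) p q - s * ((K - J) p i * K i q) := by
      ext p q
      rw [mul_sub, mul_one, mul_vecMulVec]
      simp [vecMulVec_apply]
    rw [h1]
    ext p q
    rw [Matrix.sub_apply, tiltKernel_apply, ← hs]
    simp only [mul_diagonal, diagonal_mul, of_apply, Matrix.sub_apply]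
    by_cases hi : i ∈ Y
    · have hJi : ∀ p, J p i = 0 := fun p => by
        by_cases h : p = i
        · subst h; simp [hJ, hi]
        · simp [hJ, h]
      have hJi' : ∀ q, J i q = 0 := fun q => by
        by_cases h : i = q
        · subst h; simp [hJ, hi]
        · simp [hJ, h]
      by_cases hp : p = i <;> by_cases hq : q = i <;>
        simp [hp, hq, hi, hJi, hJi'] <;> ring
    · have hJi : J i i = 1 := by simp [hJ, hi]
      by_cases hp : p = i <;> by_cases hq : q = i
      · subst hp; subst hq
        simp [hi, hJi, hs]
        generalize hzz : 1 + (b ^ 2 - 1) * K q q = z at *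
        field_simp
        subst hzz
        ring
      · subst hp
        have : J p q = 0 := diagonal_apply_ne _ (Ne.symm hq)
        simp [hi, hJi, hq, this, hs]; field_simp; ring
      · subst hq
        have : J p q = 0 := diagonal_apply_ne _ hp
        simp [hp, this]
      · have : J p i = 0 := diagonal_apply_ne _ hp
        simp [hp, hq, this]; ring
  have hdet : (1 - vecMulVec (Pi.single i s) (K i)).det = 1 / (1 + (b ^ 2 - 1) * K i i) := by
    have : (1 - vecMulVec (Pi.single i s) (K i)) =
        1 + vecMulVec (Pi.single i (-s)) (K i) := by
      rw [Pi.single_neg, neg_vecMulVec, sub_eq_add_neg]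
    rw [this, vecMulVec_eq Unit, det_one_add_replicateCol_mul_replicateRow]
    rw [dotProduct_single, eq_div_iff hz, hs, mul_neg, ← sub_eq_add_neg, sub_mul, mul_assoc,
      div_mul_cancel₀ _ hz]
    ring
  have hd : ∀ c : ℝ, (diagonal (fun p : n => if p = i then c else 1)).det = c := by
    intro c; rw [det_diagonal]; simp
  rw [hfac, det_mul, det_mul, det_mul, hdet, hd, hd]
  split_ifs <;> field_simp

end Tilt

theorem isCompact_setOf_posSemidef_one_sub {n : Type*} [Fintype n] [DecidableEq n] :
    IsCompact {K : Matrix n n ℝ | K.PosSemidef ∧ (1 - K).PosSemidef} := by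
  have hclosed : IsClosed {K : Matrix n n ℝ | K.PosSemidef} := by
    have : {K : Matrix n n ℝ | K.PosSemidef} =
        {K | Kᴴ = K} ∩ ⋂ x : n → ℝ, {K | 0 ≤ star x ⬝ᵥ (K *ᵥ x)} := by
      ext K
      simp [posSemidef_iff_dotProduct_mulVec, IsHermitian]
    rw [this]
    refine (isClosed_eq (by fun_prop) (by fun_prop)).inter (isClosed_iInter fun x => ?_)
    exact isClosed_le (by fun_prop) (by fun_prop)
  have hbox : IsCompact (Set.univ.pi fun _ : n => Set.univ.pi fun _ : n => Set.Icc (-1 : ℝ) 1) :=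
    isCompact_univ_pi fun _ => isCompact_univ_pi fun _ => isCompact_Icc
  refine hbox.of_isClosed_subset
    (hclosed.inter (hclosed.preimage (f := fun K : Matrix n n ℝ => 1 - K) (by fun_prop))) ?_
  intro (K : Matrix n n ℝ) ⟨hK, (hK' : (1 - K).PosSemidef)⟩ p _ q _
  have hd : ∀ i, 0 ≤ K i i ∧ K i i ≤ 1 := fun i =>
    ⟨hK.diag_nonneg, by simpa using hK'.diag_nonneg (i := i)⟩
  change K p q ∈ _
  have := hK.sq_mulVec_apply_le p (Pi.single q 1)
  simp at this
  rw [Set.mem_Icc, ← abs_le, ← sq_le_one_iff_abs_le_one]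
  nlinarith [hd p, hd q]

theorem eq_mul_of_forall_pow_le {c m : ℕ} {k : ℝ}
    (h : ∀ b : ℝ, 0 < b → (b ^ 2) ^ c ≤ (1 + (b ^ 2 - 1) * k) ^ m) : (c : ℝ) = m * k := by
  have hmin : IsLocalMin (fun b : ℝ => (1 + (b ^ 2 - 1) * k) ^ m - (b ^ 2) ^ c) 1 := by
    filter_upwards [lt_mem_nhds (zero_lt_one' ℝ)] with b hb
    simpa using h b hb
  have h2 : HasDerivAt (fun b : ℝ => b ^ 2) 2 1 := by
    simpa using hasDerivAt_pow 2 (1 : ℝ)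
  have hder := ((((h2.sub_const 1).mul_const k).const_add 1).fun_pow m).fun_sub (h2.fun_pow c)
  have := hmin.hasDerivAt_eq_zero hder
  norm_num at this
  linarith

theorem stmt_10 (N m : ℕ) (hN : 0 < N) (hm : 0 < m) (X : Fin m → Finset (Fin N)) :
    ∃ K : Matrix (Fin N) (Fin N) ℝ,
      (∃ h : K.PosSemidef, ∀ i, h.isHermitian.eigenvalues i ≤ 1) ∧
      (∀ K' : Matrix (Fin N) (Fin N) ℝ,
        (∃ h' : K'.PosSemidef, ∀ i, h'.isHermitian.eigenvalues i ≤ 1) →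
        ∏ j, |(K' - Matrix.diagonal fun i => if i ∈ X j then (0 : ℝ) else 1).det| ≤
          ∏ j, |(K - Matrix.diagonal fun i => if i ∈ X j then (0 : ℝ) else 1).det|) ∧
      ∀ i, K i i = ((Finset.univ.filter fun j => i ∈ X j).card : ℝ) / m := by
  have hiff : ∀ K : Matrix (Fin N) (Fin N) ℝ,
      (∃ h : K.PosSemidef, ∀ i, h.isHermitian.eigenvalues i ≤ 1) ↔
        K ∈ {K : Matrix (Fin N) (Fin N) ℝ | K.PosSemidef ∧ (1 - K).PosSemidef} := fun K =>
    ⟨fun ⟨h, h'⟩ => ⟨h, h.isHermitian.posSemidef_one_sub_iff.2 h'⟩,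
      fun ⟨h, h'⟩ => ⟨h, h.isHermitian.posSemidef_one_sub_iff.1 h'⟩⟩
  simp only [hiff]
  set L : Matrix (Fin N) (Fin N) ℝ → ℝ := fun K =>
    ∏ j, |(K - Matrix.diagonal fun i => if i ∈ X j then (0 : ℝ) else 1).det| with hL
  have hhalf : diagonal (fun _ => 1 / 2 : Fin N → ℝ) ∈
      {K : Matrix (Fin N) (Fin N) ℝ | K.PosSemidef ∧ (1 - K).PosSemidef} := by
    refine ⟨posSemidef_diagonal_iff.2 fun _ => by norm_num, ?_⟩
    rw [← diagonal_one, diagonal_sub]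
    exact posSemidef_diagonal_iff.2 fun _ => by norm_num
  have hcont : Continuous L := by
    refine continuous_finsetProd _ fun j _ => Continuous.abs ?_
    exact Continuous.matrix_det (by fun_prop)
  obtain ⟨K, hK, hmax⟩ := isCompact_setOf_posSemidef_one_sub.exists_isMaxOn ⟨_, hhalf⟩
    hcont.continuousOn
  refine ⟨K, hK, fun K' hK' => hmax hK', fun i => ?_⟩
  have hpos : 0 < L K := by
    refine lt_of_lt_of_le ?_ (hmax hhalf)
    refine Finset.prod_pos fun j _ => abs_pos.2 ?_
    rw [diagonal_sub, det_diagonal]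
    refine Finset.prod_ne_zero_iff.2 fun p _ => ?_
    split_ifs <;> norm_num
  have h0 : 0 ≤ K i i := hK.1.diag_nonneg
  have h1 : K i i ≤ 1 := by simpa using hK.2.diag_nonneg (i := i)
  have hle := eq_mul_of_forall_pow_le (c := (Finset.univ.filter fun j => i ∈ X j).card) (m := m)
    (k := K i i) fun b hb => by
      have hz := one_add_sq_sub_one_mul_pos hb h0 h1
      have hmem : tiltKernel K i b ∈
          {K : Matrix (Fin N) (Fin N) ℝ | K.PosSemidef ∧ (1 - K).PosSemidef} := by
        refine ⟨posSemidef_tiltKernel hK.1 i h1 hb, ?_⟩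
        rw [one_sub_tiltKernel K i hb hz.ne']
        exact posSemidef_tiltKernel hK.2 i (by simpa using h0) (inv_pos.2 hb)
      have hLe : L (tiltKernel K i b) ≤ L K := hmax hmem
      have hLt : L (tiltKernel K i b) =
          (b ^ 2) ^ (Finset.univ.filter fun j => i ∈ X j).card /
            (1 + (b ^ 2 - 1) * K i i) ^ m * L K := by
        have hq : ∀ j, 0 ≤ (if i ∈ X j then b ^ 2 else 1) / (1 + (b ^ 2 - 1) * K i i) := fun j =>
          div_nonneg (by split_ifs <;> positivity) hz.le
        simp only [hL, det_tiltKernel_sub K i hb hz.ne', abs_mul, abs_of_nonneg (hq _),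
          Finset.prod_mul_distrib, Finset.prod_div_distrib, Finset.prod_ite, Finset.prod_const,
          one_pow, mul_one, Finset.card_univ, Fintype.card_fin]
      rw [hLt, mul_le_iff_le_one_left hpos, div_le_one (pow_pos hz m)] at hLe
      exact hLe
  rw [hle]
  field_simp
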